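/- arXiv:2111.05606 — 2 statements merged into one kernel-verified Lean document; each statement's English description precedes it below -/
import Mathlib

section
/- The correlation kernel of an N-orthogonal polynomial ensemble with weight ω is the Christoffel–Darboux projection kernel onto polynomials of degree < N: the point process on E with joint density C_N ∏_{1≤i<j≤N}(x_i−x_j)^2 with respect to ω^{⊗N} is determinantal with kernel K_N(x,y) = ∑_{k=0}^{N−1} φ_k(x)φ_k(y), where (φ_k) are the orthonormal polynomials for ω. In particular its n-point correlation functions equal det(K_N(x_i,x_j))_{i,j=1}^n with respect to ω. -/
open MeasureTheory

section Determinantal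

/-- Cauchy–Binet type expansion of the determinant of a projection kernel. -/
lemma det_sum_mul_eq_sum_embedding {α ι κ : Type*} [Fintype ι] [Fintype κ] [DecidableEq κ]
    (ψ : ι → α → ℝ) (y : κ → α) :
    (Matrix.of fun i j : κ => ∑ k, ψ k (y i) * ψ k (y j)).det
      = ∑ σ : κ ↪ ι, ∑ π : Equiv.Perm κ, ((Equiv.Perm.sign π : ℤ) : ℝ) *
          ∏ j, (ψ (σ j) (y j) * ψ (σ (π j)) (y j)) := by
  classical
  have hexp : (Matrix.of fun i j : κ => ∑ k, ψ k (y i) * ψ k (y j)).det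
      = ∑ r : κ → ι, (∏ i, ψ (r i) (y i)) * (Matrix.of fun i j : κ => ψ (r i) (y j)).det := by
    have := (Matrix.detRowAlternating (R := ℝ) (n := κ)).toMultilinearMap.map_sum
      (fun (i : κ) (k : ι) (j : κ) => ψ k (y i) * ψ k (y j))
    simp_rw [← Matrix.det_mul_column]
    refine Eq.trans ?_ this
    refine congrArg Matrix.det ?_
    ext i j
    simp
  have hzero : ∀ r : κ → ι, ¬ Function.Injective r →
      (∏ i, ψ (r i) (y i)) * (Matrix.of fun i j : κ => ψ (r i) (y j)).det = 0 := by
    intro r hr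
    simp only [Function.Injective, not_forall] at hr
    obtain ⟨i, j, hij, hne⟩ := hr
    rw [Matrix.det_zero_of_row_eq hne (by ext; simp [hij]), mul_zero]
  rw [hexp]
  have hsum := Finset.sum_of_injOn (s := (Finset.univ : Finset (κ ↪ ι)))
    (t := (Finset.univ : Finset (κ → ι)))
    (f := fun σ => (∏ i, ψ (σ i) (y i)) * (Matrix.of fun i j : κ => ψ (σ i) (y j)).det)
    (g := fun r => (∏ i, ψ (r i) (y i)) * (Matrix.of fun i j : κ => ψ (r i) (y j)).det)
    (fun σ => (σ : κ → ι)) DFunLike.coe_injective.injOn (by simp)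
    (fun r _ hr => hzero r fun hinj => hr ⟨⟨r, hinj⟩, by simp, rfl⟩) (fun _ _ => rfl)
  rw [← hsum]
  refine Finset.sum_congr rfl fun σ _ => ?_
  rw [Matrix.det_apply', Finset.mul_sum]
  refine Finset.sum_congr rfl fun π _ => ?_
  rw [Finset.prod_mul_distrib]
  simp only [Matrix.of_apply]
  ring

variable {α ι κ : Type*} [MeasurableSpace α] {μ : Measure α} [SigmaFinite μ]
  [Fintype ι]

/-- Integrating out the coordinates outside the range of an embedding, for an integrand that is a
function of the coordinates in the range times a product of functions of single coordinates. -/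
lemma integral_pi_comp_embedding_mul_prod [DecidableEq ι] [Fintype κ] (σ : κ ↪ ι)
    (f : (κ → α) → ℝ) (g : ι → α → ℝ) :
    ∫ x : ι → α, f (fun k => x (σ k)) * ∏ i, g i (x i) ∂(Measure.pi fun _ => μ)
      = (∫ y : κ → α, f y * ∏ k, g (σ k) (y k) ∂(Measure.pi fun _ => μ)) *
        ∏ i : {i // ¬ i ∈ Set.range σ}, ∫ a, g i a ∂μ := by
  classical
  let e : κ ≃ {i // i ∈ Set.range σ} := Equiv.ofInjective σ σ.injective
  have hsplit := (measurePreserving_piEquivPiSubtypeProd (fun _ : ι => μ)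
    (fun i => i ∈ Set.range σ)).integral_comp'
      (fun z => (f (fun k => z.1 (e k)) * ∏ i : {i // i ∈ Set.range σ}, g i (z.1 i)) *
        ∏ i : {i // ¬ i ∈ Set.range σ}, g i (z.2 i))
  have hreindex := (measurePreserving_piCongrLeft
    (fun _ : {i // i ∈ Set.range σ} => μ) e).integral_comp'
      (fun z => f (fun k => z (e k)) * ∏ i : {i // i ∈ Set.range σ}, g i (z i))
  have hprod := hsplit.trans (integral_prod_mul
    (fun z : {i // i ∈ Set.range σ} → α =>
      f (fun k => z (e k)) * ∏ i : {i // i ∈ Set.range σ}, g i (z i))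
    (fun z : {i // ¬ i ∈ Set.range σ} → α => ∏ i : {i // ¬ i ∈ Set.range σ}, g i (z i)))
  rw [integral_fintype_prod_eq_prod (fun (i : {i // ¬ i ∈ Set.range σ}) a => g i a)] at hprod
  convert hprod using 2
  · ext x
    rw [← Fintype.prod_subtype_mul_prod_subtype (fun i => i ∈ Set.range σ), ← mul_assoc]
    congr!
  · refine Eq.trans ?_ (hreindex.trans (by congr!))
    congr 1
    ext y
    rw [← e.prod_comp]
    simp only [MeasurableEquiv.coe_piCongrLeft, Equiv.piCongrLeft_apply_apply]
    rfl

lemma integrable_pi_comp_embedding_mul_prod (σ : κ ↪ ι) {f : (κ → α) → ℝ} (hf : Measurable f)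
    {C : ℝ} (hC : ∀ y, |f y| ≤ C) {g : ι → α → ℝ} (hg : ∀ i, Integrable (g i) μ) :
    Integrable (fun x : ι → α => f (fun k => x (σ k)) * ∏ i, g i (x i))
      (Measure.pi fun _ => μ) :=
  (Integrable.fintype_prod hg).bdd_mul
    (hf.comp (measurable_pi_lambda _ fun _ => measurable_pi_apply _)).aestronglyMeasurable
    (.of_forall fun _ => hC _)

/-- A sum over the permutations fixing every point outside the range of an embedding. -/
lemma sum_perm_ite_fixing_compl_range {ι κ : Type*} [Fintype ι] [DecidableEq ι] [Fintype κ]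
    [DecidableEq κ] (σ : κ ↪ ι) (h : Equiv.Perm ι → ℝ)
    [DecidablePred fun ρ : Equiv.Perm ι => ∀ i, i ∉ Set.range σ → ρ i = i] :
    ∑ ρ : Equiv.Perm ι, (if ∀ i, i ∉ Set.range σ → ρ i = i then h ρ else 0)
      = ∑ π : Equiv.Perm κ, h (π.viaEmbedding σ) := by
  classical
  rw [← Finset.sum_filter]
  symm
  refine Finset.sum_bij (fun π _ => π.viaEmbedding σ) ?_ ?_ ?_ (fun _ _ => rfl)
  · intro π _
    simpa using fun i hi => π.viaEmbedding_apply_of_notMem σ i (by simpa using hi)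
  · intro π _ π' _ hπ
    exact Equiv.Perm.viaEmbeddingHom_injective σ hπ
  · intro ρ hρ
    have hρ : ∀ i, i ∉ Set.range σ → ρ i = i := (Finset.mem_filter.mp hρ).2
    let e : κ ≃ {i // i ∈ Set.range σ} := Equiv.ofInjective σ σ.injective
    let ρ' := (Equiv.Perm.subtypeEquivSubtypePerm (fun i => i ∈ Set.range σ)).symm ⟨ρ, hρ⟩
    refine ⟨e.symm.permCongr ρ', Finset.mem_univ _, ?_⟩
    ext i
    by_cases hi : i ∈ Set.range σ
    · obtain ⟨k, rfl⟩ := hi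
      rw [Equiv.Perm.viaEmbedding_apply]
      change ((e (e.symm (ρ' (e k)))) : ι) = ρ (σ k)
      rw [Equiv.apply_symm_apply]
      rfl
    · rw [Equiv.Perm.viaEmbedding_apply_of_notMem _ _ _ hi, hρ i hi]


/-- The correlation functions of the ensemble with density proportional to the squared determinant
of an orthonormal family are the determinants of the associated projection kernel. -/
theorem sum_integral_mul_det_sq_eq_factorial_mul_integral_det [DecidableEq ι] [Fintype κ]
    [DecidableEq κ] (ψ : ι → α → ℝ)
    (hint : ∀ j k, Integrable (fun a => ψ j a * ψ k a) μ)
    (horth : ∀ j k, (∫ a, ψ j a * ψ k a ∂μ) = if j = k then (1 : ℝ) else 0)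
    {f : (κ → α) → ℝ} (hf : Measurable f) {C : ℝ} (hC : ∀ y, |f y| ≤ C) :
    ∫ x : ι → α, (∑ σ : κ ↪ ι, f (fun k => x (σ k))) *
        (Matrix.of fun i k => ψ i (x k)).det ^ 2 ∂(Measure.pi fun _ => μ)
      = (Fintype.card ι).factorial * ∫ y : κ → α,
          f y * (Matrix.of fun i j : κ => ∑ k, ψ k (y i) * ψ k (y j)).det
          ∂(Measure.pi fun _ => μ) := by
  classical
  let T : (κ ↪ ι) → Equiv.Perm κ → ℝ := fun σ π => ∫ y : κ → α,
    f y * ∏ j, (ψ (σ j) (y j) * ψ (σ (π j)) (y j)) ∂(Measure.pi fun _ => μ)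
  let S : (κ ↪ ι) → ℝ := fun σ => ∑ π : Equiv.Perm κ, ((Equiv.Perm.sign π : ℤ) : ℝ) * T σ π
  have hright : ∫ y : κ → α, f y * (Matrix.of fun i j : κ => ∑ k, ψ k (y i) * ψ k (y j)).det
      ∂(Measure.pi fun _ => μ) = ∑ σ, S σ := by
    have hI : ∀ (σ : κ ↪ ι) (π : Equiv.Perm κ), Integrable (fun y : κ → α =>
        ((Equiv.Perm.sign π : ℤ) : ℝ) * (f y * ∏ j, (ψ (σ j) (y j) * ψ (σ (π j)) (y j))))
        (Measure.pi fun _ => μ) := fun σ π =>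
      (integrable_pi_comp_embedding_mul_prod (.refl κ) hf hC
        (g := fun j a => ψ (σ j) a * ψ (σ (π j)) a) (fun j => hint _ _)).const_mul _
    simp_rw [det_sum_mul_eq_sum_embedding, Finset.mul_sum, mul_left_comm (f _)]
    rw [integral_finsetSum _ fun σ _ => integrable_finsetSum _ fun π _ => hI σ π]
    refine Finset.sum_congr rfl fun σ _ => ?_
    rw [integral_finsetSum _ fun π _ => hI σ π]
    exact Finset.sum_congr rfl fun π _ => integral_const_mul _ _
  have hterm : ∀ (σ : κ ↪ ι) (τ ρ : Equiv.Perm ι),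
      ∫ x : ι → α, f (fun k => x (σ k)) * ∏ i, (ψ (τ i) (x i) * ψ ((τ * ρ) i) (x i))
        ∂(Measure.pi fun _ => μ)
      = if ∀ i, i ∉ Set.range σ → ρ i = i then
          ∫ y : κ → α, f y * ∏ j, (ψ (τ (σ j)) (y j) * ψ (τ (ρ (σ j))) (y j))
            ∂(Measure.pi fun _ => μ)
        else 0 := by
    intro σ τ ρ
    rw [integral_pi_comp_embedding_mul_prod σ f fun i a => ψ (τ i) a * ψ ((τ * ρ) i) a]
    simp only [horth, Equiv.Perm.mul_apply, EmbeddingLike.apply_eq_iff_eq]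
    split_ifs with h
    · rw [Finset.prod_eq_one, mul_one]
      exact fun i _ => if_pos (h i i.2).symm
    · push Not at h
      obtain ⟨i, hi, hne⟩ := h
      rw [Finset.prod_eq_zero (Finset.mem_univ ⟨i, hi⟩) (if_neg hne.symm), mul_zero]
  have hI : ∀ (σ : κ ↪ ι) (τ ρ : Equiv.Perm ι), Integrable (fun x : ι → α =>
      ((Equiv.Perm.sign ρ : ℤ) : ℝ) *
        (f (fun k => x (σ k)) * ∏ i, (ψ (τ i) (x i) * ψ ((τ * ρ) i) (x i))))
      (Measure.pi fun _ => μ) := fun σ τ ρ =>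
    (integrable_pi_comp_embedding_mul_prod σ hf hC
      (g := fun i a => ψ (τ i) a * ψ ((τ * ρ) i) a) (fun i => hint _ _)).const_mul _
  have hdet : ∀ x : ι → α, (Matrix.of fun i k => ψ i (x k)).det ^ 2
      = ∑ τ : Equiv.Perm ι, ∑ ρ : Equiv.Perm ι, ((Equiv.Perm.sign ρ : ℤ) : ℝ) *
          ∏ i, (ψ (τ i) (x i) * ψ ((τ * ρ) i) (x i)) := by
    intro x
    rw [sq, Matrix.det_apply', Finset.sum_mul]
    refine Finset.sum_congr rfl fun τ _ => ?_
    rw [← Equiv.sum_comp (Equiv.mulLeft τ), Finset.mul_sum]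
    refine Finset.sum_congr rfl fun ρ _ => ?_
    have hs : ((Equiv.Perm.sign τ : ℤ) : ℝ) * ((Equiv.Perm.sign τ : ℤ) : ℝ) = 1 := by
      rcases Int.units_eq_one_or (Equiv.Perm.sign τ) with h | h <;> simp [h]
    rw [Finset.prod_mul_distrib]
    simp only [Matrix.of_apply, Equiv.coe_mulLeft, Equiv.Perm.sign_mul, Units.val_mul,
      Int.cast_mul]
    linear_combination (((Equiv.Perm.sign ρ : ℤ) : ℝ) * (∏ i, ψ (τ i) (x i)) *
      ∏ i, ψ ((τ * ρ) i) (x i)) * hs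
  rw [hright]
  simp_rw [hdet, Finset.sum_mul, Finset.mul_sum, mul_left_comm (f _)]
  rw [integral_finsetSum _ fun σ _ => integrable_finsetSum _ fun τ _ =>
    integrable_finsetSum _ fun ρ _ => hI σ τ ρ]
  have hσ : ∀ σ : κ ↪ ι, (∫ x : ι → α, ∑ τ : Equiv.Perm ι, ∑ ρ : Equiv.Perm ι,
      ((Equiv.Perm.sign ρ : ℤ) : ℝ) *
        (f (fun k => x (σ k)) * ∏ i, (ψ (τ i) (x i) * ψ ((τ * ρ) i) (x i)))
        ∂(Measure.pi fun _ => μ)) = ∑ τ : Equiv.Perm ι, S (σ.trans τ.toEmbedding) := by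
    intro σ
    rw [integral_finsetSum _ fun τ _ => integrable_finsetSum _ fun ρ _ => hI σ τ ρ]
    refine Finset.sum_congr rfl fun τ _ => ?_
    rw [integral_finsetSum _ fun ρ _ => hI σ τ ρ]
    simp_rw [integral_const_mul, hterm, mul_ite, mul_zero]
    rw [sum_perm_ite_fixing_compl_range σ fun ρ => ((Equiv.Perm.sign ρ : ℤ) : ℝ) *
      ∫ y : κ → α, f y * ∏ j, (ψ (τ (σ j)) (y j) * ψ (τ (ρ (σ j))) (y j))
            ∂(Measure.pi fun _ => μ)]
    refine Finset.sum_congr rfl fun π _ => ?_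
    simp only [Equiv.Perm.viaEmbedding_apply]
    rw [Equiv.Perm.viaEmbedding, Equiv.Perm.sign_extendDomain]
    rfl
  rw [Finset.sum_congr rfl fun σ _ => hσ σ, Finset.sum_comm]
  have hτ : ∀ τ : Equiv.Perm ι, ∑ σ : κ ↪ ι, S (σ.trans τ.toEmbedding) = ∑ σ, S σ := fun τ =>
    (Equiv.embeddingCongr (Equiv.refl κ) τ).sum_comp S
  rw [Finset.sum_congr rfl fun τ _ => hτ τ, Finset.sum_const, Finset.card_univ,
    Fintype.card_perm, nsmul_eq_mul, Finset.mul_sum]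

end Determinantal

section OrthogonalPolynomials

lemma integrable_polynomial_eval {ω : Measure ℝ} (hmom : ∀ k : ℕ, Integrable (fun x => |x| ^ k) ω)
    (p : Polynomial ℝ) : Integrable (fun x => p.eval x) ω := by
  simp_rw [Polynomial.eval_eq_sum_range]
  refine integrable_finsetSum _ fun i _ => Integrable.const_mul ?_ _
  exact (hmom i).mono' (by fun_prop) (.of_forall fun x => by simp)

lemma matrix_eval_eq_coeff_mul_vandermonde_transpose {R : Type*} [CommRing R] {N : ℕ}
    {p : Fin N → Polynomial R} (hp : ∀ k, (p k).natDegree < N) (x : Fin N → R) :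
    (Matrix.of fun i k => (p i).eval (x k))
      = (Matrix.of fun i j : Fin N => (p i).coeff j) * (Matrix.vandermonde x).transpose := by
  ext i k
  rw [Matrix.of_apply, Polynomial.eval_eq_sum_range' (hp i), Finset.sum_range]
  simp [Matrix.mul_apply, Matrix.vandermonde_apply]

/-- The Gram matrix of a family of polynomials in terms of the Hankel matrix of moments. -/
lemma gram_eq_coeff_mul_hankel_mul_transpose {ω : Measure ℝ}
    (hmom : ∀ k : ℕ, Integrable (fun x => |x| ^ k) ω) {N : ℕ}
    {p : Fin N → Polynomial ℝ} (hp : ∀ k, (p k).natDegree < N) :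
    (Matrix.of fun i j => ∫ x, (p i).eval x * (p j).eval x ∂ω)
      = (Matrix.of fun i j : Fin N => (p i).coeff j) *
        (Matrix.of fun i j : Fin N => ∫ x, x ^ ((i : ℕ) + (j : ℕ)) ∂ω) *
        (Matrix.of fun i j : Fin N => (p i).coeff j).transpose := by
  have hpow : ∀ k : ℕ, Integrable (fun x => x ^ k) ω := fun k => by
    simpa using integrable_polynomial_eval hmom (Polynomial.X ^ k)
  ext i j
  have hexp : ∀ x, (p i).eval x * (p j).eval x = ∑ b : Fin N, ∑ a : Fin N,
      ((p i).coeff a * (p j).coeff b) * x ^ ((a : ℕ) + (b : ℕ)) := by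
    intro x
    rw [Polynomial.eval_eq_sum_range' (hp i), Polynomial.eval_eq_sum_range' (hp j),
      Finset.sum_range, Finset.sum_range, Finset.sum_mul_sum, Finset.sum_comm]
    exact Finset.sum_congr rfl fun b _ => Finset.sum_congr rfl fun a _ => by ring
  rw [Matrix.of_apply]
  simp_rw [hexp]
  rw [integral_finsetSum _ fun b _ => integrable_finsetSum _ fun a _ => (hpow _).const_mul _]
  simp_rw [Matrix.mul_apply, Finset.sum_mul]
  refine Finset.sum_congr rfl fun b _ => ?_
  rw [integral_finsetSum _ fun a _ => (hpow _).const_mul _]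
  refine Finset.sum_congr rfl fun a _ => ?_
  rw [integral_const_mul]
  simp only [Matrix.of_apply, Matrix.transpose_apply]
  ring

lemma prod_filter_lt_sub_sq_eq_det_vandermonde_sq {R : Type*} [CommRing R] {N : ℕ}
    (x : Fin N → R) :
    ∏ p ∈ Finset.univ.filter (fun p : Fin N × Fin N => p.1 < p.2), (x p.1 - x p.2) ^ 2
      = (Matrix.vandermonde x).det ^ 2 := by
  rw [Matrix.det_vandermonde, ← Finset.prod_pow, Finset.prod_filter, Fintype.prod_prod_type]
  refine Finset.prod_congr rfl fun i _ => ?_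
  rw [← Finset.prod_pow, ← Finset.prod_filter]
  refine Finset.prod_congr (by ext; simp) fun j _ => ?_
  ring

end OrthogonalPolynomials

/-- The `N`-orthogonal polynomial ensemble with weight `ω` (the measure on
`E^N` with density `C_N·∏_{i<j}(x_i−x_j)²` with respect to `ω^{⊗N}`, where
`C_N = (N!·m_N)⁻¹` and `m_N` is the Hankel determinant of moments) is determinantal with
correlation kernel the Christoffel–Darboux kernel `K_N(x,y) = ∑_{k<N} φ_k(x)φ_k(y)` built
from the orthonormal polynomials `φ_k` for `ω`: its `n`-point correlation functions are
`det(K_N(x_i,x_j))` with respect to `ω`. -/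
theorem ope_correlation_kernel_christoffel_darboux
    (ω : Measure ℝ) [SigmaFinite ω]
    (hmom : ∀ k : ℕ, Integrable (fun x => |x| ^ k) ω)
    (N : ℕ) (hN : 0 < N)
    (φ : ℕ → ℝ → ℝ)
    (hpoly : ∀ k, ∃ p : Polynomial ℝ, p.natDegree = k ∧ ∀ x, φ k x = p.eval x)
    (horth : ∀ j k, (∫ x, φ j x * φ k x ∂ω) = if j = k then (1 : ℝ) else 0)
    (mN : ℝ)
    (hmN : mN = Matrix.det (Matrix.of fun i j : Fin N =>
      ∫ x, x ^ ((i : ℕ) + (j : ℕ)) ∂ω))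
    (PN : Measure (Fin N → ℝ))
    (hPN : PN = (Measure.pi fun _ => ω).withDensity (fun x =>
      ENNReal.ofReal (((Nat.factorial N : ℝ) * mN)⁻¹ *
        ∏ p ∈ Finset.univ.filter (fun p : Fin N × Fin N => p.1 < p.2),
          (x p.1 - x p.2) ^ 2)))
    (n : ℕ) (f : (Fin n → ℝ) → ℝ)
    (hfm : Measurable f) (hfb : ∃ C : ℝ, ∀ y, |f y| ≤ C) :
    (∫ x, (∑ σ : Fin n ↪ Fin N, f (fun i => x (σ i))) ∂PN)
      = ∫ y : Fin n → ℝ,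
          f y * Matrix.det (Matrix.of fun i j : Fin n =>
            ∑ k ∈ Finset.range N, φ k (y i) * φ k (y j))
          ∂(Measure.pi fun _ => ω) := by
  obtain ⟨C, hC⟩ := hfb
  choose q hdeg hq using hpoly
  let p : Fin N → Polynomial ℝ := fun k => q k
  have hp : ∀ k, (p k).natDegree < N := fun k => by simp [p, hdeg]
  let A : Matrix (Fin N) (Fin N) ℝ := Matrix.of fun i j : Fin N => (p i).coeff j
  have horth' : ∀ j k : Fin N, (∫ x, (p j).eval x * (p k).eval x ∂ω)
      = if j = k then (1 : ℝ) else 0 := fun j k => by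
    simpa [hq, p, Fin.ext_iff] using horth j k
  have hA : A.det ^ 2 * mN = 1 := by
    have h := congrArg Matrix.det (gram_eq_coeff_mul_hankel_mul_transpose hmom hp)
    have hone : (Matrix.of fun i j => ∫ x, (p i).eval x * (p j).eval x ∂ω) = 1 := by
      ext i j
      simp [horth', Matrix.one_apply]
    rw [hone, Matrix.det_one, Matrix.det_mul, Matrix.det_mul, Matrix.det_transpose, ← hmN] at h
    linear_combination -h
  have hmN_inv : mN⁻¹ = A.det ^ 2 := inv_eq_of_mul_eq_one_left hA
  have hdens : ∀ x : Fin N → ℝ, ((Nat.factorial N : ℝ) * mN)⁻¹ *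
      ∏ p ∈ Finset.univ.filter (fun p : Fin N × Fin N => p.1 < p.2), (x p.1 - x p.2) ^ 2
      = (Nat.factorial N : ℝ)⁻¹ * (Matrix.of fun i k => (p i).eval (x k)).det ^ 2 := by
    intro x
    rw [prod_filter_lt_sub_sq_eq_det_vandermonde_sq, mul_inv, hmN_inv,
      matrix_eval_eq_coeff_mul_vandermonde_transpose hp, Matrix.det_mul, Matrix.det_transpose]
    ring
  rw [hPN, integral_withDensity_eq_integral_toReal_smul (by fun_prop)
    (.of_forall fun _ => ENNReal.ofReal_lt_top)]
  have hcorr := sum_integral_mul_det_sq_eq_factorial_mul_integral_det (μ := ω)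
    (fun (k : Fin N) x => (p k).eval x)
    (fun j k => by simpa using integrable_polynomial_eval hmom (p j * p k)) horth' hfm hC
  rw [Fintype.card_fin] at hcorr
  have hker : ∀ s t : ℝ, ∑ k ∈ Finset.range N, φ k s * φ k t
      = ∑ k : Fin N, (p k).eval s * (p k).eval t := fun s t => by
    rw [Finset.sum_range]
    simp [hq, p]
  simp_rw [hker]
  have hfac : (Nat.factorial N : ℝ) ≠ 0 := by positivity
  rw [← inv_mul_eq_iff_eq_mul₀ hfac] at hcorr
  rw [← hcorr, ← integral_const_mul]
  refine integral_congr_ae (.of_forall fun x => ?_)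
  simp only [smul_eq_mul]
  rw [hdens, ENNReal.toReal_ofReal (by positivity)]
  ring
end

section
/- Giambelli compatibility of orthogonal polynomial ensembles: let P_N be the N-orthogonal polynomial ensemble on E ⊆ ℝ with weight ω, R > 0, and define for a configuration X = {x_1,…,x_N} the specialization ρ_0^R sending the power sum p_k to ∑_{j=1}^N (x_j + iR)^{−k}. Then for every Young diagram λ with Frobenius notation (p_1,…,p_d | q_1,…,q_d) and ℓ(λ) ≤ N, E_{P_N}[ρ_0^R(s_λ)(X)] = det(E_{P_N}[ρ_0^R(s_{(p_i|q_j)})(X)])_{i,j=1}^d. -/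
open MeasureTheory

/-- The complete homogeneous symmetric polynomial `h_m` in `N` variables, evaluated at
`y : Fin N → ℂ`: the sum over all `m`-element multisets of the variables of the product. -/
noncomputable def hCompleteEval (N m : ℕ) (y : Fin N → ℂ) : ℂ :=
  ∑ s : Sym (Fin N) m, ((s : Multiset (Fin N)).map y).prod

/-- `h_k` for `k : ℤ`, vanishing in negative degrees. -/
noncomputable def hCompleteEvalZ (N : ℕ) (k : ℤ) (y : Fin N → ℂ) : ℂ :=
  if 0 ≤ k then hCompleteEval N k.toNat y else 0

/-- The Schur polynomial `s_λ` in `N` variables, via the Jacobi–Trudi determinant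
`det(h_{λ_i-i+j})_{i,j=1}^N` (valid for `ℓ(λ) ≤ N`), evaluated at `y : Fin N → ℂ`. -/
noncomputable def schurEval (N : ℕ) (lam : ℕ → ℕ) (y : Fin N → ℂ) : ℂ :=
  Matrix.det (Matrix.of fun i j : Fin N =>
    hCompleteEvalZ N ((lam i : ℤ) - (i : ℕ) + (j : ℕ)) y)

/-- The Schur polynomial of the hook `(p|q) = (p+1, 1^q)` in `N` variables, via the
Jacobi–Trudi determinant of size `q+1`, evaluated at `y : Fin N → ℂ`. -/
noncomputable def hookSchurEval (N p q : ℕ) (y : Fin N → ℂ) : ℂ :=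
  Matrix.det (Matrix.of fun i j : Fin (q + 1) =>
    hCompleteEvalZ N ((if (i : ℕ) = 0 then (p : ℤ) + 1 else 1) - (i : ℕ) + (j : ℕ)) y)

lemma hCompleteEval_eq_sum_finsuppAntidiag (N m : ℕ) (y : Fin N → ℂ) :
    hCompleteEval N m y =
      ∑ l ∈ Finset.finsuppAntidiag Finset.univ m, ∏ i, y i ^ l i := by
  classical
  unfold hCompleteEval
  refine Finset.sum_bij (fun s _ => ((Sym.equivNatSum (Fin N) m s : _) : Fin N →₀ ℕ)) ?_ ?_ ?_ ?_
  · intro s _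
    have h := (Sym.equivNatSum (Fin N) m s).2
    rw [Finsupp.sum_fintype _ _ (fun _ => rfl)] at h
    exact Finset.mem_finsuppAntidiag.mpr ⟨h, Finset.subset_univ _⟩
  · intro s _ t _ h
    exact (Sym.equivNatSum (Fin N) m).injective (Subtype.ext h)
  · intro l hl
    refine ⟨(Sym.equivNatSum (Fin N) m).symm ⟨l, ?_⟩, Finset.mem_univ _, by simp⟩
    rw [Finsupp.sum_fintype _ _ (fun _ => rfl)]
    simpa using hl
  · intro s _
    rw [Finset.prod_multiset_map_count, Finset.prod_subset (Finset.subset_univ _)]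
    · rfl
    · intro i _ hi
      rw [Multiset.count_eq_zero_of_notMem (by simpa using hi), pow_zero]

lemma mk_pow_mul_one_sub (a : ℂ) :
    (PowerSeries.mk fun n => a ^ n) * (1 - PowerSeries.C a * PowerSeries.X) = 1 := by
  ext n
  rw [mul_sub, mul_one, mul_left_comm]
  cases n with
  | zero => simp
  | succ n =>
    simp [pow_succ, mul_comm]

/-- The generating polynomial `∏_{l ≠ k} (1 - y_l t)`. -/
noncomputable def erasedProd {N : ℕ} (y : Fin N → ℂ) (k : Fin N) : Polynomial ℂ :=
  ∏ l ∈ Finset.univ.erase k, (1 - Polynomial.C (y l) * Polynomial.X)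

lemma natDegree_erasedProd_lt {N : ℕ} (y : Fin N → ℂ) (k : Fin N) :
    (erasedProd y k).natDegree < N := by
  have hN : 0 < N := k.pos
  have h1 : (erasedProd y k).natDegree ≤ ∑ l ∈ Finset.univ.erase k, 1 := by
    refine (Polynomial.natDegree_prod_le _ _).trans (Finset.sum_le_sum fun l _ => ?_)
    compute_degree
  simp at h1
  omega

lemma mk_hCompleteEval_mul_erasedProd {N : ℕ} (y : Fin N → ℂ) (k : Fin N) :
    (PowerSeries.mk fun m => hCompleteEval N m y) * (erasedProd y k : PowerSeries ℂ) =
      PowerSeries.mk fun n => y k ^ n := by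
  have hgen : (PowerSeries.mk fun m => hCompleteEval N m y) =
      ∏ l, PowerSeries.mk fun n => y l ^ n := by
    ext m
    simp [PowerSeries.coeff_prod, hCompleteEval_eq_sum_finsuppAntidiag]
  have hcoe : (erasedProd y k : PowerSeries ℂ) =
      ∏ l ∈ Finset.univ.erase k, (1 - PowerSeries.C (y l) * PowerSeries.X) := by
    unfold erasedProd
    rw [← Polynomial.coeToPowerSeries.ringHom_apply, map_prod]
    simp
  rw [hgen, hcoe, ← Finset.mul_prod_erase _ _ (Finset.mem_univ k), mul_assoc,
    ← Finset.prod_mul_distrib, Finset.prod_congr rfl fun l _ => mk_pow_mul_one_sub (y l)]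
  simp

lemma sum_hCompleteEvalZ_mul_coeff {N : ℕ} (y : Fin N → ℂ) (k : Fin N) (n : ℕ) :
    ∑ j : Fin N, hCompleteEvalZ N ((n : ℤ) - (j : ℕ)) y * (erasedProd y k).coeff j =
      y k ^ n := by
  have h := congrArg (PowerSeries.coeff n) (mk_hCompleteEval_mul_erasedProd y k)
  rw [mul_comm, PowerSeries.coeff_mul, Finset.Nat.sum_antidiagonal_eq_sum_range_succ_mk] at h
  simp only [PowerSeries.coeff_mk, Polynomial.coeff_coe] at h
  rw [← h, Fin.sum_univ_eq_sum_range
    (fun j => hCompleteEvalZ N ((n : ℤ) - (j : ℕ)) y * (erasedProd y k).coeff j)]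
  have e1 : ∀ j ∈ Finset.range (n + 1 + N), j ∉ Finset.range N →
      hCompleteEvalZ N ((n : ℤ) - (j : ℕ)) y * (erasedProd y k).coeff j = 0 := by
    intro j _ hj
    rw [Polynomial.coeff_eq_zero_of_natDegree_lt, mul_zero]
    have := natDegree_erasedProd_lt y k
    simp at hj
    omega
  have e2 : ∀ j ∈ Finset.range (n + 1 + N), j ∉ Finset.range (n + 1) →
      hCompleteEvalZ N ((n : ℤ) - (j : ℕ)) y * (erasedProd y k).coeff j = 0 := by
    intro j _ hj
    simp at hj
    rw [hCompleteEvalZ, if_neg (by omega), zero_mul]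
  rw [Finset.sum_subset (Finset.range_mono (by omega)) e1,
    ← Finset.sum_subset (Finset.range_mono (by omega)) e2]
  refine Finset.sum_congr rfl fun j hj => ?_
  simp at hj
  rw [hCompleteEvalZ, if_pos (by omega), mul_comm]
  congr 3
  omega

lemma hCompleteEval_zero (N : ℕ) (y : Fin N → ℂ) : hCompleteEval N 0 y = 1 := by
  simp [hCompleteEval_eq_sum_finsuppAntidiag]

/-- The Jacobi–Trudi determinant only involves the nonzero parts of the partition. -/
lemma schurEval_eq_det_of_le {N r : ℕ} (hr : r ≤ N) (lam : ℕ → ℕ)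
    (hlam : ∀ i, r ≤ i → lam i = 0) (y : Fin N → ℂ) :
    schurEval N lam y = Matrix.det (Matrix.of fun i j : Fin r =>
      hCompleteEvalZ N ((lam i : ℤ) - (i : ℕ) + (j : ℕ)) y) := by
  unfold schurEval
  rw [Matrix.twoBlockTriangular_det _ (fun i : Fin N => (i : ℕ) < r)]
  · have hlow : (Matrix.toSquareBlockProp (Matrix.of fun i j : Fin N =>
        hCompleteEvalZ N ((lam i : ℤ) - (i : ℕ) + (j : ℕ)) y)
          fun i : Fin N => ¬ (i : ℕ) < r).det = 1 := by
      rw [Matrix.det_of_isUpperTriangular]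
      · refine Finset.prod_eq_one fun i _ => ?_
        have := hlam i.1 (by simpa using i.2)
        simp [Matrix.toSquareBlockProp, hCompleteEvalZ, this, hCompleteEval_zero]
      · intro i j hij
        have := hlam i.1 (by simpa using i.2)
        have h2 : (j.1 : ℕ) < i.1 := hij
        change hCompleteEvalZ N ((lam i.1 : ℤ) - ((i.1 : Fin N) : ℕ) + ((j.1 : Fin N) : ℕ)) y = 0
        rw [hCompleteEvalZ, this, if_neg (by omega)]
    rw [hlow, mul_one]
    let e : Fin r ≃ {i : Fin N // (i : ℕ) < r} :=
      { toFun := fun i => ⟨⟨i, by omega⟩, i.2⟩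
        invFun := fun i => ⟨i.1, i.2⟩
        left_inv := fun _ => rfl
        right_inv := fun _ => rfl }
    rw [← Matrix.det_submatrix_equiv_self e]
    rfl
  · intro i hi j hj
    have := hlam i (by omega)
    simp only [Matrix.of_apply, hCompleteEvalZ]
    rw [if_neg (by omega)]

lemma schurEval_zero (N : ℕ) (y : Fin N → ℂ) : schurEval N (fun _ => 0) y = 1 := by
  rw [schurEval_eq_det_of_le (Nat.zero_le N) _ (fun _ _ => rfl)]
  simp

/-- The bialternant formula. -/
lemma schurEval_mul_det {N : ℕ} (lam : ℕ → ℕ) (y : Fin N → ℂ) (hy : ∀ k, y k ≠ 0) :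
    schurEval N lam y * Matrix.det (Matrix.of fun i k : Fin N => y k ^ (-((i : ℕ) : ℤ))) =
      Matrix.det (Matrix.of fun i k : Fin N => y k ^ ((lam i : ℤ) - (i : ℕ))) := by
  set M : Matrix (Fin N) (Fin N) ℂ := Matrix.of fun j k =>
    (erasedProd y k).coeff (Fin.rev j) * y k ^ (-((N : ℤ) - 1)) with hM
  have key (mu : ℕ → ℕ) : schurEval N mu y * M.det =
      Matrix.det (Matrix.of fun i k : Fin N => y k ^ ((mu i : ℤ) - (i : ℕ))) := by
    rw [schurEval, ← Matrix.det_mul]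
    congr 1
    ext i k
    have h := sum_hCompleteEvalZ_mul_coeff y k (mu i + (Fin.rev i : ℕ))
    rw [← Equiv.sum_comp Fin.revPerm] at h
    simp only [Matrix.mul_apply, Matrix.of_apply, hM, ← mul_assoc, ← Finset.sum_mul]
    have h2 : ∀ j : Fin N, (mu i : ℤ) - (i : ℕ) + (j : ℕ) =
        ((mu i + (Fin.rev i : ℕ) : ℕ) : ℤ) - ((Fin.revPerm j : Fin N) : ℕ) := by
      intro j
      simp [Fin.val_rev]
      omega
    simp_rw [h2]
    simp only [Fin.revPerm_apply] at h ⊢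
    rw [h, ← zpow_natCast, ← zpow_add₀ (hy k)]
    congr 1
    simp [Fin.val_rev]
    omega
  have h0 := key fun _ => 0
  rw [schurEval_zero, one_mul] at h0
  rw [← key lam, h0]
  simp

/-- The parts of the hook `(p + 1, 1 ^ q)`. -/
def hookParts (p q i : ℕ) : ℕ := if i = 0 then p + 1 else if i ≤ q then 1 else 0

lemma hookSchurEval_eq_schurEval {N p q : ℕ} (hq : q < N) (y : Fin N → ℂ) :
    hookSchurEval N p q y = schurEval N (hookParts p q) y := by
  rw [schurEval_eq_det_of_le (r := q + 1) hq, hookSchurEval]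
  · congr 1
    ext i j
    simp only [Matrix.of_apply, hookParts]
    have : (i : ℕ) ≤ q := by omega
    split_ifs <;> simp
  · intro i hi
    rw [hookParts, if_neg (by omega), if_neg (by omega)]

/-- A permutation which is increasing from `d` on and decreasing on `[0, d)`, with values below
`σ i`, `i < d`, coming from indices beyond `i`, has sign `∏_{i < d} (-1) ^ σ i`. -/
lemma sign_eq_prod_neg_one_pow {N d : ℕ} (σ : Equiv.Perm (Fin N))
    (hlow : ∀ i j : Fin N, (i : ℕ) < d → j < i → σ i < σ j)
    (hhigh : ∀ i j : Fin N, d ≤ (i : ℕ) → i < j → σ i < σ j) :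
    σ.sign = ∏ i : Fin N, if (i : ℕ) < d then (-1) ^ (σ i : ℕ) else 1 := by
  rw [Equiv.Perm.sign_eq_prod_prod_Ioi]
  refine Finset.prod_congr rfl fun i _ => ?_
  split_ifs with hi
  · rw [Finset.prod_ite, Finset.prod_const_one, one_mul, Finset.prod_const]
    congr 1
    have : (Finset.Ioi i).filter (fun j => ¬ σ i < σ j) =
        (Finset.Iio (σ i)).map σ.symm.toEmbedding := by
      ext j
      simp only [Finset.mem_filter, Finset.mem_Ioi, Finset.mem_map_equiv, Equiv.symm_symm,
        Finset.mem_Iio, not_lt]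
      constructor
      · rintro ⟨h1, h2⟩
        exact lt_of_le_of_ne h2 fun h => h1.ne' (σ.injective h)
      · intro h
        refine ⟨?_, h.le⟩
        rcases lt_trichotomy i j with h' | h' | h'
        · exact h'
        · exact absurd h (by simp [h'])
        · exact absurd h (hlow i j hi h').not_gt
    rw [this, Finset.card_map, Fin.card_Iio]
  · refine Finset.prod_eq_one fun j hj => ?_
    rw [if_pos (hhigh i j (by omega) (by simpa using hj))]

/-- A determinantal Giambelli formula: if the row `b (-i)` is the `i`-th standard basis vector
for `0 ≤ i < N`, the determinant of the rows `b (λ_i - i)` is the determinant of the signed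
entries of `b` at the Frobenius coordinates of `λ`. -/
lemma det_rows_eq_det_frobenius {K : Type*} [CommRing K] {N : ℕ} (b : ℤ → Fin N → K)
    (hb : ∀ i : Fin N, b (-((i : ℕ) : ℤ)) = Pi.single i 1)
    (lam : ℕ → ℕ) (hmono : Antitone lam)
    (d : ℕ) (hd : ∀ i : ℕ, i < d ↔ i < lam i) (P Q : ℕ → ℕ)
    (hP : ∀ a, a < d → lam a = P a + a + 1)
    (hQ : ∀ a, a < d → ∀ j, a < lam j ↔ j < Q a + a + 1)
    (hdN : d ≤ N) (hQN : ∀ a : Fin d, Q a < N) :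
    Matrix.det (Matrix.of fun i k : Fin N => b ((lam i : ℤ) - (i : ℕ)) k) =
      Matrix.det (Matrix.of fun a c : Fin d =>
        (-1) ^ Q c * b ((P a : ℤ) + 1) ⟨Q c, hQN c⟩) := by
  have hle : ∀ i, d ≤ i → lam i ≤ i := fun i hi => by
    by_contra! h
    have := (hd i).2 h
    omega
  have hQanti : ∀ i j, i < d → j < i → Q i < Q j := by
    intro i j hi hj
    have h1 := (hQ i hi (Q i + i)).2 (by omega)
    have h2 := (hQ j (by omega) (Q i + i)).1 (by omega)
    omega
  have hne : ∀ i j, i < d → d ≤ j → Q i ≠ j - lam j := by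
    intro i j hi hj h
    have h1 := hQ i hi j
    have h2 := hle j hj
    omega
  have hmono' : ∀ i j, d ≤ i → i < j → i - lam i < j - lam j := by
    intro i j hi hij
    have h1 := hmono hij.le
    have h2 := hle i hi
    omega
  let s : Fin N → Fin N := fun i =>
    if h : (i : ℕ) < d then ⟨Q i, hQN ⟨i, h⟩⟩ else ⟨i - lam i, by omega⟩
  have s_low : ∀ i : Fin N, (i : ℕ) < d → (s i : ℕ) = Q i := fun i hi => by simp [s, hi]
  have s_high : ∀ i : Fin N, d ≤ (i : ℕ) → (s i : ℕ) = i - lam i := fun i hi => by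
    simp [s, not_lt.2 hi]
  have s_inj : Function.Injective s := by
    have key : ∀ i j : Fin N, i < j → s i ≠ s j := by
      intro i j hij h
      have h' := congrArg Fin.val h
      rcases lt_or_ge (i : ℕ) d with hi | hi <;> rcases lt_or_ge (j : ℕ) d with hj | hj
      · rw [s_low i hi, s_low j hj] at h'
        exact (hQanti j i hj hij).ne' h'
      · rw [s_low i hi, s_high j hj] at h'
        exact hne i j hi hj h'
      · exact absurd hij (by simp only [Fin.lt_def]; omega)
      · rw [s_high i hi, s_high j hj] at h'
        exact (hmono' i j hi hij).ne h'
    intro i j h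
    by_contra hij
    rcases lt_or_gt_of_ne hij with h1 | h1
    · exact key i j h1 h
    · exact key j i h1 h.symm
  let σ : Equiv.Perm (Fin N) := Equiv.ofBijective s (Finite.injective_iff_bijective.1 s_inj)
  have hsign : σ.sign = ∏ i : Fin N, if (i : ℕ) < d then (-1) ^ (σ i : ℕ) else 1 := by
    apply sign_eq_prod_neg_one_pow
    · intro i j hi hj
      change (s i : ℕ) < s j
      rw [s_low i hi, s_low j (lt_trans hj hi)]
      exact hQanti i j hi hj
    · intro i j hi hj
      change (s i : ℕ) < s j
      rw [s_high i hi, s_high j (hi.trans hj.le)]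
      exact hmono' i j hi hj
  have hsign' : ((σ.sign : ℤ) : K) = ∏ a : Fin d, (-1) ^ Q a := by
    rw [hsign]
    have h1 : ∀ i : Fin N, (((if (i : ℕ) < d then (-1) ^ (σ i : ℕ) else 1 : ℤˣ) : ℤ) : K) =
        if (i : ℕ) < d then (-1) ^ Q i else 1 := by
      intro i
      split_ifs with hi
      · have : (σ i : ℕ) = Q i := s_low i hi
        simp [this]
      · simp
    rw [Units.coe_prod, Int.cast_prod, Finset.prod_congr rfl fun i _ => h1 i,
      Fin.prod_univ_eq_prod_range (fun i => if i < d then (-1 : K) ^ Q i else 1),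
      Fin.prod_univ_eq_prod_range (fun i => (-1 : K) ^ Q i), ← Finset.prod_filter]
    refine Finset.prod_congr ?_ fun _ _ => rfl
    ext i
    simp
    omega
  set M : Matrix (Fin N) (Fin N) K :=
    Matrix.of fun i k : Fin N => b ((lam i : ℤ) - (i : ℕ)) k with hM
  have hrow : ∀ i j : Fin N, d ≤ (i : ℕ) → M i (σ j) = if i = j then 1 else 0 := by
    intro i j hi
    have h1 : ((lam i : ℤ) - (i : ℕ)) = -((s i : ℕ) : ℤ) := by
      rw [s_high i hi]
      have := hle i hi
      omega
    rw [hM, Matrix.of_apply, h1, hb, Pi.single_apply]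
    change (if s j = s i then (1 : K) else 0) = _
    simp [s_inj.eq_iff, eq_comm]
  have hdet : (M.submatrix id σ).det =
      Matrix.det (Matrix.of fun a c : Fin d => b ((P a : ℤ) + 1) ⟨Q c, hQN c⟩) := by
    rw [Matrix.twoBlockTriangular_det _ (fun i : Fin N => (i : ℕ) < d)]
    · have hone : (Matrix.toSquareBlockProp (M.submatrix id σ)
          fun i : Fin N => ¬ (i : ℕ) < d) = 1 := by
        ext i j
        change M i.1 (σ j.1) = _
        rw [hrow i.1 j.1 (by simpa using i.2), Matrix.one_apply]
        simp [Subtype.ext_iff]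
      rw [hone, Matrix.det_one, mul_one]
      let e : Fin d ≃ {i : Fin N // (i : ℕ) < d} :=
        { toFun := fun i => ⟨⟨i, by omega⟩, i.2⟩
          invFun := fun i => ⟨i.1, i.2⟩
          left_inv := fun _ => rfl
          right_inv := fun _ => rfl }
      rw [← Matrix.det_submatrix_equiv_self e]
      congr 1
      ext a c
      change b ((lam a : ℤ) - (a : ℕ)) (s ⟨c, by omega⟩) = b ((P a : ℤ) + 1) ⟨Q c, hQN c⟩
      have h1 : (lam a : ℤ) - (a : ℕ) = (P a : ℤ) + 1 := by
        rw [hP a a.2]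
        push_cast
        ring
      rw [h1]
      congr 1
      exact Fin.ext (s_low _ c.2)
    · intro i hi j hj
      change M i (σ j) = 0
      rw [hrow i j (by omega), if_neg]
      rintro rfl
      exact hi hj
  have hperm := Matrix.det_permute' σ M
  rw [hdet, hsign'] at hperm
  have hsq : (∏ a : Fin d, (-1 : K) ^ Q a) * ∏ a : Fin d, (-1 : K) ^ Q a = 1 := by
    rw [← Finset.prod_mul_distrib]
    exact Finset.prod_eq_one fun a _ => by rw [← mul_pow]; simp
  have hscale := Matrix.det_mul_row (fun c : Fin d => (-1 : K) ^ Q c)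
    (Matrix.of fun a c : Fin d => b ((P a : ℤ) + 1) ⟨Q c, hQN c⟩)
  simp only [Matrix.of_apply] at hscale
  rw [hscale, hperm, ← mul_assoc, hsq, one_mul]

/-- Andréief's identity. -/
lemma integral_det_mul_det {E : Type*} [MeasurableSpace E] (μ : Measure E) [SigmaFinite μ]
    {N : ℕ} (f g : Fin N → E → ℂ) (hfg : ∀ i k, Integrable (fun x => f i x * g k x) μ) :
    ∫ x : Fin N → E, Matrix.det (Matrix.of fun i j => f i (x j)) *
        Matrix.det (Matrix.of fun i j => g i (x j)) ∂(Measure.pi fun _ => μ) =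
      (N.factorial : ℂ) * Matrix.det (Matrix.of fun i k => ∫ x, f i x * g k x ∂μ) := by
  have hexp : ∀ x : Fin N → E, Matrix.det (Matrix.of fun i j => f i (x j)) *
        Matrix.det (Matrix.of fun i j => g i (x j)) =
      ∑ σ : Equiv.Perm (Fin N), ∑ τ : Equiv.Perm (Fin N),
        (((σ.sign : ℤ) : ℂ) * ((τ.sign : ℤ) : ℂ)) * ∏ j, f (σ j) (x j) * g (τ j) (x j) := by
    intro x
    rw [Matrix.det_apply', Matrix.det_apply', Finset.sum_mul_sum]
    refine Finset.sum_congr rfl fun σ _ => Finset.sum_congr rfl fun τ _ => ?_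
    rw [Finset.prod_mul_distrib]
    simp only [Matrix.of_apply]
    ring
  have h_int : ∀ σ τ : Equiv.Perm (Fin N), Integrable (fun x : Fin N → E =>
      (((σ.sign : ℤ) : ℂ) * ((τ.sign : ℤ) : ℂ)) * ∏ j, f (σ j) (x j) * g (τ j) (x j))
      (Measure.pi fun _ => μ) := fun σ τ =>
    (Integrable.fintype_prod (f := fun j x => f (σ j) x * g (τ j) x)
      fun j => hfg _ _).const_mul _
  simp_rw [hexp]
  rw [integral_finsetSum _ fun σ _ => integrable_finsetSum _ fun τ _ => h_int σ τ]
  have hinner : ∀ σ : Equiv.Perm (Fin N),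
      ∫ x : Fin N → E, ∑ τ : Equiv.Perm (Fin N), (((σ.sign : ℤ) : ℂ) * ((τ.sign : ℤ) : ℂ)) *
        ∏ j, f (σ j) (x j) * g (τ j) (x j) ∂(Measure.pi fun _ => μ) =
      Matrix.det (Matrix.of fun i k => ∫ x, f i x * g k x ∂μ) := by
    intro σ
    rw [integral_finsetSum _ fun τ _ => h_int σ τ]
    have h1 : ∀ τ : Equiv.Perm (Fin N),
        ∫ x : Fin N → E, (((σ.sign : ℤ) : ℂ) * ((τ.sign : ℤ) : ℂ)) *
          ∏ j, f (σ j) (x j) * g (τ j) (x j) ∂(Measure.pi fun _ => μ) =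
        ((σ.sign : ℤ) : ℂ) * (((τ.sign : ℤ) : ℂ) * ∏ j, ∫ x, f (σ j) x * g (τ j) x ∂μ) := by
      intro τ
      rw [integral_const_mul,
        integral_fintype_prod_eq_prod (fun j x => f (σ j) x * g (τ j) x), mul_assoc]
    rw [Finset.sum_congr rfl fun τ _ => h1 τ, ← Finset.mul_sum]
    have h2 := Matrix.det_permute σ (Matrix.of fun i k => ∫ x, f i x * g k x ∂μ)
    rw [← Matrix.det_transpose, Matrix.det_apply'] at h2
    simp only [Matrix.transpose_apply, Matrix.submatrix_apply, Matrix.of_apply, id] at h2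
    rw [h2, ← mul_assoc, ← Int.cast_mul, ← Units.val_mul, Int.units_mul_self]
    simp
  rw [Finset.sum_congr rfl fun σ _ => hinner σ]
  simp [Fintype.card_perm]

lemma ofReal_add_mul_I_ne_zero {R : ℝ} (hR : 0 < R) (x : ℝ) : (x : ℂ) + R * Complex.I ≠ 0 := by
  intro h
  have := congrArg Complex.im h
  simp at this
  exact hR.ne' this

lemma integrable_zpow_mul_pow {ω : Measure ℝ}
    (hmom : ∀ k : ℕ, Integrable (fun x => |x| ^ k) ω) {R : ℝ} (hR : 0 < R) (l : ℤ) (k : ℕ) :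
    Integrable (fun x : ℝ => ((x : ℂ) + R * Complex.I)⁻¹ ^ l * (x : ℂ) ^ k) ω := by
  have hpow : ∀ m : ℕ, Integrable (fun x : ℝ => (x : ℂ) ^ m) ω := fun m =>
    (hmom m).mono' (by fun_prop) (by simp)
  rcases le_or_gt 0 l with hl | hl
  · lift l to ℕ using hl
    refine (hpow k).bdd_mul (c := R⁻¹ ^ l) (by fun_prop) (ae_of_all _ fun x => ?_)
    rw [zpow_natCast, norm_pow, norm_inv]
    gcongr
    have := Complex.abs_im_le_norm ((x : ℂ) + R * Complex.I)
    simp [abs_of_pos hR] at this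
    exact this
  · obtain ⟨n, rfl⟩ : ∃ n : ℕ, l = -(n : ℤ) := ⟨l.natAbs, by omega⟩
    have h1 : ∀ x : ℝ, ((x : ℂ) + R * Complex.I)⁻¹ ^ (-(n : ℤ)) * (x : ℂ) ^ k =
        ∑ m ∈ Finset.range (n + 1),
          ((R * Complex.I) ^ (n - m) * (n.choose m)) * (x : ℂ) ^ (m + k) := by
      intro x
      rw [zpow_neg, inv_zpow, inv_inv, zpow_natCast, add_pow, Finset.sum_mul]
      refine Finset.sum_congr rfl fun m _ => ?_
      ring
    simp_rw [h1]
    exact integrable_finsetSum _ fun m _ => (hpow _).const_mul _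

lemma prod_sub_sq_eq_det_mul_det {N : ℕ} (x : Fin N → ℝ) (R : ℝ) :
    ((∏ p ∈ Finset.univ.filter (fun p : Fin N × Fin N => p.1 < p.2),
        (x p.1 - x p.2) ^ 2 : ℝ) : ℂ) =
      Matrix.det (Matrix.of fun i k : Fin N =>
        ((x k : ℂ) + R * Complex.I)⁻¹ ^ (-((i : ℕ) : ℤ))) *
      Matrix.det (Matrix.of fun i k : Fin N => (x k : ℂ) ^ (i : ℕ)) := by
  have h1 : (Matrix.of fun i k : Fin N =>
      ((x k : ℂ) + R * Complex.I)⁻¹ ^ (-((i : ℕ) : ℤ))) =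
      (Matrix.vandermonde fun k => (x k : ℂ) + R * Complex.I).transpose := by
    ext i k
    simp [Matrix.vandermonde_apply]
  have h2 : (Matrix.of fun i k : Fin N => (x k : ℂ) ^ (i : ℕ)) =
      (Matrix.vandermonde fun k => (x k : ℂ)).transpose := by
    ext i k
    simp [Matrix.vandermonde_apply]
  rw [h1, h2, Matrix.det_transpose, Matrix.det_transpose, Matrix.det_vandermonde_add,
    Matrix.det_vandermonde, ← Finset.prod_mul_distrib, Finset.prod_filter, Complex.ofReal_prod,
    Finset.univ_product_univ.symm, Finset.prod_product]
  refine Finset.prod_congr rfl fun i _ => ?_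
  rw [← Finset.prod_mul_distrib, ← Complex.ofReal_prod, ← Finset.prod_filter,
    Finset.filter_lt_eq_Ioi, Complex.ofReal_prod]
  refine Finset.prod_congr rfl fun j _ => ?_
  push_cast
  ring

/-- The expectation of a Schur function in an orthogonal polynomial ensemble, up to the
normalisation `c`. -/
lemma integral_schurEval_withDensity {ω : Measure ℝ} [SigmaFinite ω]
    (hmom : ∀ k : ℕ, Integrable (fun x => |x| ^ k) ω) {N : ℕ} {R : ℝ} (hR : 0 < R)
    {c : ℝ} (hc : 0 ≤ c) (lam : ℕ → ℕ) :
    ∫ x : Fin N → ℝ, schurEval N lam (fun j => ((x j : ℂ) + R * Complex.I)⁻¹)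
        ∂((Measure.pi fun _ => ω).withDensity fun x => ENNReal.ofReal (c *
          ∏ p ∈ Finset.univ.filter (fun p : Fin N × Fin N => p.1 < p.2),
            (x p.1 - x p.2) ^ 2)) =
      c * N.factorial * Matrix.det (Matrix.of fun i k : Fin N =>
        ∫ x, ((x : ℂ) + R * Complex.I)⁻¹ ^ ((lam i : ℤ) - (i : ℕ)) * (x : ℂ) ^ (k : ℕ) ∂ω) := by
  rw [integral_withDensity_eq_integral_toReal_smul (by fun_prop)
    (ae_of_all _ fun _ => ENNReal.ofReal_lt_top)]
  have h1 : ∀ x : Fin N → ℝ, (ENNReal.ofReal (c *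
        ∏ p ∈ Finset.univ.filter (fun p : Fin N × Fin N => p.1 < p.2),
          (x p.1 - x p.2) ^ 2)).toReal •
        schurEval N lam (fun j => ((x j : ℂ) + R * Complex.I)⁻¹) =
      c * (Matrix.det (Matrix.of fun i j : Fin N =>
          ((x j : ℂ) + R * Complex.I)⁻¹ ^ ((lam i : ℤ) - (i : ℕ))) *
        Matrix.det (Matrix.of fun i j : Fin N => (x j : ℂ) ^ (i : ℕ))) := by
    intro x
    rw [ENNReal.toReal_ofReal
      (mul_nonneg hc (Finset.prod_nonneg fun p _ => sq_nonneg _)), Complex.real_smul,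
      Complex.ofReal_mul, prod_sub_sq_eq_det_mul_det x R, ← schurEval_mul_det lam _
        fun k => inv_ne_zero (ofReal_add_mul_I_ne_zero hR (x k))]
    ring
  simp_rw [h1]
  rw [integral_const_mul, integral_det_mul_det ω
    (fun i x => ((x : ℂ) + R * Complex.I)⁻¹ ^ ((lam i : ℤ) - (i : ℕ)))
    (fun k x => (x : ℂ) ^ (k : ℕ))
    (fun i k => integrable_zpow_mul_pow hmom hR _ _), mul_assoc]

lemma hookParts_antitone (p q : ℕ) : Antitone (hookParts p q) := by
  intro i j hij
  unfold hookParts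
  split_ifs <;> omega

lemma lt_apply_iff_lt_ncard_of_antitone {f : ℕ → ℕ} (hf : Antitone f) {N : ℕ}
    (hN : ∀ i, N ≤ i → f i = 0) (a j : ℕ) : a < f j ↔ j < {i | a < f i}.ncard := by
  have hex : ∃ n, f n ≤ a := ⟨N, by simp [hN N le_rfl]⟩
  have hset : {i | a < f i} = Set.Iio (Nat.find hex) := by
    ext i
    simp only [Set.mem_ofPred_eq, Set.mem_Iio, Nat.lt_find_iff, not_le]
    exact ⟨fun h m hm => h.trans_le (hf hm), fun h => h i le_rfl⟩
  have hcard : (Set.Iio (Nat.find hex)).ncard = Nat.find hex := by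
    rw [← Finset.coe_Iio, Set.ncard_coe_finset, Nat.card_Iio]
  have := Set.ext_iff.1 hset j
  rw [hset, hcard]
  exact this

/-- Giambelli compatibility of orthogonal polynomial ensembles. Let `P_N`
be the `N`-orthogonal polynomial ensemble with weight `ω`, `R > 0`, and let `ρ₀^R` send a
configuration `x` to the evaluation of symmetric functions at `y_j = 1/(x_j + iR)`.  Then
for every Young diagram `λ` (antitone `lam`, `ℓ(λ) ≤ N`) with `d` diagonal boxes and
Frobenius coordinates `P`, `Q`,
`E_{P_N}[ρ₀^R(s_λ)] = det(E_{P_N}[ρ₀^R(s_{(p_i|q_j)})])_{i,j=1}^d`. -/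
theorem ope_giambelli_compatible
    (ω : Measure ℝ) [SigmaFinite ω]
    (hmom : ∀ k : ℕ, Integrable (fun x => |x| ^ k) ω)
    (N : ℕ) (hN : 0 < N) (R : ℝ) (hR : 0 < R)
    (mN : ℝ)
    (hmN : mN = Matrix.det (Matrix.of fun i j : Fin N =>
      ∫ x, x ^ ((i : ℕ) + (j : ℕ)) ∂ω))
    (PN : Measure (Fin N → ℝ))
    (hPN : PN = (Measure.pi fun _ => ω).withDensity (fun x =>
      ENNReal.ofReal (((Nat.factorial N : ℝ) * mN)⁻¹ *
        ∏ p ∈ Finset.univ.filter (fun p : Fin N × Fin N => p.1 < p.2),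
          (x p.1 - x p.2) ^ 2)))
    (hprob : IsProbabilityMeasure PN)
    (lam : ℕ → ℕ) (hmono : Antitone lam) (hlen : ∀ i, N ≤ i → lam i = 0)
    (d : ℕ) (hd : ∀ i : ℕ, i < d ↔ i < lam i)
    (P Q : ℕ → ℕ)
    (hP : ∀ a, a < d → lam a = P a + a + 1)
    (hQ : ∀ a, a < d → {j : ℕ | a < lam j}.ncard = Q a + a + 1) :
    (∫ x : Fin N → ℝ,
        schurEval N lam (fun j => ((x j : ℂ) + R * Complex.I)⁻¹) ∂PN)
      = Matrix.det (Matrix.of fun a b : Fin d =>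
          ∫ x : Fin N → ℝ,
            hookSchurEval N (P a) (Q b) (fun j => ((x j : ℂ) + R * Complex.I)⁻¹) ∂PN) := by
  set c : ℝ := ((Nat.factorial N : ℝ) * mN)⁻¹
  have hc : 0 ≤ c := by
    by_contra! hneg
    have h0 : PN = 0 := by
      rw [hPN, withDensity_eq_zero_iff (by fun_prop)]
      refine ae_of_all _ fun x => ENNReal.ofReal_of_nonpos ?_
      exact mul_nonpos_of_nonpos_of_nonneg hneg.le (Finset.prod_nonneg fun p _ => sq_nonneg _)
    exact hprob.ne_zero PN h0
  let A : ℤ → Fin N → ℂ := fun l k =>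
    ∫ x, ((x : ℂ) + R * Complex.I)⁻¹ ^ l * (x : ℂ) ^ (k : ℕ) ∂ω
  have hE : ∀ mu : ℕ → ℕ,
      ∫ x : Fin N → ℝ, schurEval N mu (fun j => ((x j : ℂ) + R * Complex.I)⁻¹) ∂PN =
        c * N.factorial * Matrix.det (Matrix.of fun i k : Fin N => A ((mu i : ℤ) - (i : ℕ)) k) := by
    intro mu
    rw [hPN]
    exact integral_schurEval_withDensity hmom hR hc mu
  let G : Matrix (Fin N) (Fin N) ℂ := Matrix.of fun i k => A (-((i : ℕ) : ℤ)) k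
  have hG : (c * N.factorial : ℂ) * G.det = 1 := by
    have h := hE fun _ => 0
    simpa [schurEval_zero, G] using h.symm
  have hGunit : IsUnit G.det := IsUnit.of_mul_eq_one_right _ hG
  let b : ℤ → Fin N → ℂ := fun l => Matrix.vecMul (A l) G⁻¹
  have hb : ∀ i : Fin N, b (-((i : ℕ) : ℤ)) = Pi.single i 1 := by
    intro i
    ext k
    change (G * G⁻¹) i k = _
    rw [Matrix.mul_nonsing_inv _ hGunit, Matrix.one_apply, Pi.single_apply]
    simp [eq_comm]
  have hEb : ∀ mu : ℕ → ℕ,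
      ∫ x : Fin N → ℝ, schurEval N mu (fun j => ((x j : ℂ) + R * Complex.I)⁻¹) ∂PN =
        Matrix.det (Matrix.of fun i k : Fin N => b ((mu i : ℤ) - (i : ℕ)) k) := by
    intro mu
    have h1 : (Matrix.of fun i k : Fin N => b ((mu i : ℤ) - (i : ℕ)) k) =
        (Matrix.of fun i k : Fin N => A ((mu i : ℤ) - (i : ℕ)) k) * G⁻¹ := rfl
    rw [hE mu, h1, Matrix.det_mul, Matrix.det_nonsing_inv, Ring.inverse_eq_inv',
      ← eq_inv_of_mul_eq_one_left hG, mul_comm]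
  have hdN : d ≤ N := by
    by_contra! h
    have h1 := (hd N).1 h
    have h2 := hlen N le_rfl
    omega
  have hQ' : ∀ a, a < d → ∀ j, a < lam j ↔ j < Q a + a + 1 := fun a ha j => by
    rw [← hQ a ha, lt_apply_iff_lt_ncard_of_antitone hmono hlen]
  have hQN : ∀ a : Fin d, Q a < N := by
    intro a
    have h1 := hQ' a a.2 N
    have h2 := hlen N le_rfl
    omega
  rw [hEb, det_rows_eq_det_frobenius b hb lam hmono d hd P Q hP hQ' hdN hQN]
  congr 1
  ext a e
  simp only [Matrix.of_apply]
  simp_rw [hookSchurEval_eq_schurEval (hQN e)]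
  rw [hEb, det_rows_eq_det_frobenius b hb (hookParts (P a) (Q e)) (hookParts_antitone _ _) 1
    (fun i => by unfold hookParts; split_ifs <;> omega) (fun _ => P a) (fun _ => Q e)
    (fun i hi => by simp [hookParts, Nat.lt_one_iff.1 hi])
    (fun i hi j => by unfold hookParts; split_ifs <;> omega) (by omega) (fun _ => hQN e)]
  simp
end
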